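/- Let m ≥ 1, let a₀, a₁, …, a_m and n be positive natural numbers, and for each k = 1, …, m let U_k be an a_{k−1}×a_k real matrix with orthonormal columns (U_kᵀU_k = I), let W_k be an a_k×n real matrix, and let E_k = W_{k−1} − U_k W_k, where W₀ is a given a₀×n real matrix. Suppose U_kᵀ E_k = 0 and ‖E_k‖_F ≤ ε_k for every k, where ε₁, …, ε_m are nonnegative reals. Then ‖W₀ − U₁ U₂ ⋯ U_m W_m‖_F ≤ sqrt(∑_{k=1}^{m} ε_k²). -/

import Mathlib

open Matrix

/-- The Frobenius norm of a real matrix: `sqrt (∑ i j, M i j ^ 2)`. -/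
noncomputable def frobNorm {p q : ℕ} (M : Matrix (Fin p) (Fin q) ℝ) : ℝ :=
  Real.sqrt (∑ i, ∑ j, (M i j) ^ 2)

theorem frobNorm_sq {p q : ℕ} (M : Matrix (Fin p) (Fin q) ℝ) :
    frobNorm M ^ 2 = (Mᵀ * M).trace := by
  rw [frobNorm, Real.sq_sqrt (by positivity), Finset.sum_comm]
  simp [Matrix.trace, Matrix.mul_apply, sq]

/-- Pythagoras: if `P` has orthonormal columns, orthogonal to those of `D`, then the squared
Frobenius norm of `D + P * E` is the sum of those of `D` and `E`. -/
theorem frobNorm_add_mul_sq {p q r : ℕ} {D : Matrix (Fin p) (Fin q) ℝ}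
    {P : Matrix (Fin p) (Fin r) ℝ} (E : Matrix (Fin r) (Fin q) ℝ)
    (hP : Pᵀ * P = 1) (hPD : Pᵀ * D = 0) :
    frobNorm (D + P * E) ^ 2 = frobNorm D ^ 2 + frobNorm E ^ 2 := by
  have hDP : Dᵀ * P = 0 := by simpa using congrArg Matrix.transpose hPD
  have key : (D + P * E)ᵀ * (D + P * E) = Dᵀ * D + Eᵀ * E := by
    rw [transpose_add, transpose_mul, Matrix.add_mul, Matrix.mul_add, Matrix.mul_add,
      ← Matrix.mul_assoc Dᵀ, hDP, Matrix.mul_assoc Eᵀ, hPD, Matrix.mul_assoc Eᵀ,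
      ← Matrix.mul_assoc Pᵀ, hP]
    simp
  simp only [frobNorm_sq, key, trace_add]

/-- MPO truncation error bound (Theorem S.1, matrix level): if
`E_k = W_{k-1} − U_k W_k` with `U_kᵀ U_k = 1`, `U_kᵀ E_k = 0` and
`‖E_k‖_F ≤ ε_k` for every `k`, and `P_k = U_1 ⋯ U_k` denotes the partial
products (`P_0 = 1`, `P_{k+1} = P_k U_{k+1}`), then
`‖W_0 − U_1 ⋯ U_m W_m‖_F ≤ sqrt (∑_{k=1}^m ε_k²)`. -/
theorem frobNorm_mpo_truncation_bound
    (m n : ℕ) (hm : 1 ≤ m) (a : Fin (m + 1) → ℕ)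
    (ha : ∀ k, 0 < a k) (hn : 0 < n)
    (U : (k : Fin m) → Matrix (Fin (a k.castSucc)) (Fin (a k.succ)) ℝ)
    (W : (k : Fin (m + 1)) → Matrix (Fin (a k)) (Fin n) ℝ)
    (E : (k : Fin m) → Matrix (Fin (a k.castSucc)) (Fin n) ℝ)
    (ε : Fin m → ℝ) (hε : ∀ k, 0 ≤ ε k)
    (hE : ∀ k, E k = W k.castSucc - U k * W k.succ)
    (hUU : ∀ k, (U k)ᵀ * U k = 1)
    (hUE : ∀ k, (U k)ᵀ * E k = 0)
    (hEε : ∀ k, frobNorm (E k) ≤ ε k)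
    (P : (k : Fin (m + 1)) → Matrix (Fin (a 0)) (Fin (a k)) ℝ)
    (hP0 : P 0 = 1)
    (hPsucc : ∀ k : Fin m, P k.succ = P k.castSucc * U k) :
    frobNorm (W 0 - P (Fin.last m) * W (Fin.last m)) ≤
      Real.sqrt (∑ k : Fin m, ε k ^ 2) := by
  have key : ∀ k : Fin (m + 1), (P k)ᵀ * P k = 1 ∧ (P k)ᵀ * (W 0 - P k * W k) = 0 ∧
      frobNorm (W 0 - P k * W k) ^ 2 ≤ ∑ i : Fin m with i.castSucc < k, ε i ^ 2 := by
    intro k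
    induction k using Fin.induction with
    | zero => simp [hP0, frobNorm]
    | succ k ih =>
      obtain ⟨hPP, hPD, hle⟩ := ih
      have hD : W 0 - P k.succ * W k.succ = (W 0 - P k.castSucc * W k.castSucc) +
          P k.castSucc * E k := by
        rw [hE, hPsucc, Matrix.mul_sub, Matrix.mul_assoc]
        abel
      have hfilter : (Finset.univ.filter fun i : Fin m => i.castSucc < k.succ) =
          insert k (Finset.univ.filter fun i : Fin m => i.castSucc < k.castSucc) := by
        ext i
        simp [Fin.castSucc_lt_succ_iff, le_iff_eq_or_lt]
      refine ⟨?_, ?_, ?_⟩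
      · rw [hPsucc, transpose_mul, Matrix.mul_assoc, ← Matrix.mul_assoc (P k.castSucc)ᵀ, hPP,
          Matrix.one_mul, hUU]
      · rw [hD, hPsucc, transpose_mul, Matrix.mul_assoc, Matrix.mul_add, hPD,
          ← Matrix.mul_assoc (P k.castSucc)ᵀ, hPP, Matrix.one_mul, zero_add, hUE]
      · rw [hD, frobNorm_add_mul_sq _ hPP hPD, hfilter, Finset.sum_insert (by simp), add_comm]
        exact add_le_add (pow_le_pow_left₀ (Real.sqrt_nonneg _) (hEε k) 2) hle
  refine Real.le_sqrt_of_sq_le ?_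
  simpa [Fin.castSucc_lt_last] using (key (Fin.last m)).2.2
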